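/- arXiv:math/0405383 — 2 statements merged into one kernel-verified Lean document; each statement's English description precedes it below -/
import Mathlib

section
/- Let d = 2m be even with m ≥ 2, and let k_j = k₁ for odd j and k_j = k₂ for even j. For every integer i ≥ 0 and every value of k₁ ∈ ℂ, the polynomial f = (Z^m − W^m)^{2i+1} is singular (i.e. D_Z(f) = 0 and D_W(f) = 0) if and only if k₂ = i + 1/2. -/
open MvPolynomial
open scoped Classical

noncomputable section

/-- The polynomial ring `ℂ[Z,W]`, with `Z = X 0` and `W = X 1`. -/
abbrev R2 : Type := MvPolynomial (Fin 2) ℂ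

/-- `ζ = exp(2πi/d)`. -/
def zeta (d : ℕ) : ℂ := Complex.exp (2 * Real.pi * Complex.I / d)

/-- The action of the reflection `s_j` of `I₂(d)` on `ℂ[Z,W]`:
`Z ↦ ζ^j·W`, `W ↦ ζ^{-j}·Z`. -/
def reflAct (d j : ℕ) : R2 →ₐ[ℂ] R2 :=
  aeval ![C (zeta d ^ j) * X 1, C ((zeta d ^ j)⁻¹) * X 0]

/-- Exact division: if `a ∣ b` in `ℂ[Z,W]` this is the (unique, when `a ≠ 0`)
quotient, and `0` otherwise. -/
def exQuot (a b : R2) : R2 := if h : ∃ c, b = a * c then Classical.choose h else 0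

/-- The Dunkl operator `D_Z` with parameters `k₁,…,k_d`. -/
def DZ (d : ℕ) (k : ℕ → ℂ) (f : R2) : R2 :=
  pderiv (0 : Fin 2) f - ∑ j ∈ Finset.Icc 1 d,
    C (k j) * exQuot (X 0 - C (zeta d ^ j) * X 1) (f - reflAct d j f)

/-- The Dunkl operator `D_W` with parameters `k₁,…,k_d`. -/
def DW (d : ℕ) (k : ℕ → ℂ) (f : R2) : R2 :=
  pderiv (1 : Fin 2) f - ∑ j ∈ Finset.Icc 1 d,
    C (k j) * exQuot (X 1 - C ((zeta d ^ j)⁻¹) * X 0) (f - reflAct d j f)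

theorem exQuot_mul_left {a : R2} (ha : a ≠ 0) (c : R2) : exQuot a (a * c) = c := by
  have h : ∃ c', a * c = a * c' := ⟨c, rfl⟩
  rw [exQuot, dif_pos h]
  exact (mul_left_cancel₀ ha (Classical.choose_spec h)).symm

theorem exQuot_zero_right {a : R2} (ha : a ≠ 0) : exQuot a 0 = 0 := by
  simpa using exQuot_mul_left ha 0

theorem X_sub_C_mul_X_ne_zero {a b : Fin 2} (hab : a ≠ b) (c : ℂ) :
    (X a - C c * X b : R2) ≠ 0 := by
  intro h
  simpa [hab.symm, Pi.single_apply] using congrArg (pderiv a) h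

theorem zeta_isPrimitiveRoot {d : ℕ} (hd : d ≠ 0) : IsPrimitiveRoot (zeta d) d :=
  Complex.isPrimitiveRoot_exp d hd

theorem zeta_two_mul_pow_half {m : ℕ} (hm : m ≠ 0) : zeta (2 * m) ^ m = -1 := by
  have h := (zeta_isPrimitiveRoot (d := 2 * m) (by omega)).pow (by omega) (mul_comm 2 m)
  exact h.eq_neg_one_of_two_right

theorem reflAct_pow_sub_pow {m : ℕ} (hm : m ≠ 0) (j : ℕ) :
    reflAct (2 * m) j (X 0 ^ m - X 1 ^ m) = (-1) ^ (j + 1) * (X 0 ^ m - X 1 ^ m) := by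
  have h : (zeta (2 * m) ^ j) ^ m = (-1) ^ j := by
    rw [pow_right_comm, zeta_two_mul_pow_half hm]
  have h' : ((-1 : ℂ) ^ j)⁻¹ = (-1) ^ j := by rw [← inv_pow]; norm_num
  simp only [reflAct, map_sub, map_pow, aeval_X, Matrix.cons_val_zero, Matrix.cons_val_one,
    mul_pow]
  rw [← C_pow, ← C_pow, ← C_pow, inv_pow, h, h']
  simp only [map_pow, map_neg, map_one]
  ring

theorem prod_X_sub_C_pow_mul_X {m : ℕ} (hm : 0 < m) {η : ℂ} (hη : IsPrimitiveRoot η m)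
    (a b : Fin 2) :
    ∏ l ∈ Finset.Icc 1 m, (X a - C (η ^ l) * X b : R2) = X a ^ m - X b ^ m := by
  have hC : IsPrimitiveRoot (C η : R2) m := hη.map_of_injective (C_injective (Fin 2) ℂ)
  have hinj : Set.InjOn (fun l => (C η : R2) ^ l) (Finset.Icc 1 m : Finset ℕ) := by
    intro x hx y hy hxy
    rw [Finset.mem_coe, Finset.mem_Icc] at hx hy
    obtain ⟨x, rfl⟩ := Nat.exists_eq_add_of_le' hx.1
    obtain ⟨y, rfl⟩ := Nat.exists_eq_add_of_le' hy.1
    simp only [pow_succ] at hxy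
    rw [hC.pow_inj (by omega) (by omega) (mul_right_cancel₀ (hC.ne_zero hm.ne') hxy)]
  have himage : (Finset.Icc 1 m).image (fun l => (C η : R2) ^ l)
      = Polynomial.nthRootsFinset m (1 : R2) := by
    refine Finset.eq_of_subset_of_card_le ?_ ?_
    · intro x hx
      obtain ⟨l, -, rfl⟩ := Finset.mem_image.1 hx
      rw [Polynomial.mem_nthRootsFinset hm, ← pow_mul, mul_comm, pow_mul, hC.pow_eq_one, one_pow]
    · rw [hC.card_nthRootsFinset, Finset.card_image_of_injOn hinj, Nat.card_Icc,
        Nat.add_sub_cancel]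
  rw [hC.pow_sub_pow_eq_prod_sub_mul _ _ hm, ← himage, Finset.prod_image hinj]
  simp only [C_pow]

theorem pderiv_prod_of_pderiv_eq_one {ι : Type*} (S : Finset ι) (L : ι → R2) (a : Fin 2)
    (hd : ∀ l ∈ S, pderiv a (L l) = 1) :
    pderiv a (∏ l ∈ S, L l) = ∑ l ∈ S, ∏ l' ∈ S.erase l, L l' := by
  induction S using Finset.induction_on with
  | empty => simp
  | insert x S hx ih =>
    rw [Finset.prod_insert hx, pderiv_mul, hd x (Finset.mem_insert_self x S), one_mul,
      ih fun l hl => hd l (Finset.mem_insert_of_mem hl), Finset.sum_insert hx,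
      Finset.erase_insert hx, Finset.mul_sum]
    congr 1
    refine Finset.sum_congr rfl fun l hl => ?_
    have hne : x ≠ l := fun h => hx (h ▸ hl)
    rw [Finset.erase_insert_of_ne hne, Finset.prod_insert fun h => hx (Finset.mem_of_mem_erase h)]

theorem sum_exQuot_prod_pow {ι : Type*} (S : Finset ι) (L : ι → R2) (s : ℂ) (n : ℕ) (a : Fin 2)
    (hL : ∀ l ∈ S, L l ≠ 0) (hd : ∀ l ∈ S, pderiv a (L l) = 1) :
    ∑ l ∈ S, exQuot (L l) (2 * (C s * ∏ l ∈ S, L l) ^ (n + 1))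
      = 2 * (C s * ∏ l ∈ S, L l) ^ n * pderiv a (C s * ∏ l ∈ S, L l) := by
  rw [pderiv_C_mul, pderiv_prod_of_pderiv_eq_one S L a hd, ← mul_assoc, Finset.mul_sum]
  refine Finset.sum_congr rfl fun l hl => ?_
  rw [← exQuot_mul_left (hL l hl) (2 * (C s * ∏ l ∈ S, L l) ^ n * C s * ∏ l' ∈ S.erase l, L l')]
  congr 1
  rw [pow_succ]
  nth_rewrite 2 [← Finset.mul_prod_erase S L hl]
  ring

theorem sum_Icc_two_mul {M : Type*} [AddCommMonoid M] (g : ℕ → M) (m : ℕ)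
    (hg : ∀ j, j % 2 = 1 → g j = 0) :
    ∑ j ∈ Finset.Icc 1 (2 * m), g j = ∑ l ∈ Finset.Icc 1 m, g (2 * l) := by
  induction m with
  | zero => simp
  | succ m ih =>
    rw [Finset.sum_Icc_succ_top (by omega), show 2 * (m + 1) = 2 * m + 1 + 1 by ring,
      Finset.sum_Icc_succ_top (by omega), Finset.sum_Icc_succ_top (by omega), ih,
      hg (2 * m + 1) (by omega), add_zero]

/-- The reflection sum in a Dunkl operator, applied to an odd power of `Z ^ m - W ^ m`, for
divisors `X a - C (ξ ^ j) * X b` along which `s * (X a ^ m - X b ^ m) = Z ^ m - W ^ m`. -/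
theorem sum_dunkl_pow_sub_pow {m : ℕ} (hm : 0 < m) (i : ℕ) (k₁ k₂ s ξ : ℂ)
    (hξ : IsPrimitiveRoot (ξ ^ 2) m) {a b : Fin 2} (hab : a ≠ b)
    (hs : C s * (X a ^ m - X b ^ m) = (X 0 ^ m - X 1 ^ m : R2)) :
    ∑ j ∈ Finset.Icc 1 (2 * m), C (if j % 2 = 1 then k₁ else k₂) *
        exQuot (X a - C (ξ ^ j) * X b) ((X 0 ^ m - X 1 ^ m) ^ (2 * i + 1)
          - reflAct (2 * m) j ((X 0 ^ m - X 1 ^ m) ^ (2 * i + 1)))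
      = C k₂ * (2 * (X 0 ^ m - X 1 ^ m) ^ (2 * i) * pderiv a (X 0 ^ m - X 1 ^ m)) := by
  have hrefl (j : ℕ) : reflAct (2 * m) j ((X 0 ^ m - X 1 ^ m) ^ (2 * i + 1))
      = (-1) ^ (j + 1) * (X 0 ^ m - X 1 ^ m) ^ (2 * i + 1) := by
    rw [map_pow, reflAct_pow_sub_pow hm.ne', mul_pow, ← pow_mul, mul_comm (j + 1), pow_mul,
      Odd.neg_one_pow ⟨i, rfl⟩]
  rw [sum_Icc_two_mul]
  · have hprod := prod_X_sub_C_pow_mul_X hm hξ a b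
    have hsum := sum_exQuot_prod_pow (Finset.Icc 1 m)
      (fun l => (X a - C ((ξ ^ 2) ^ l) * X b : R2)) s (2 * i) a
      (fun l _ => X_sub_C_mul_X_ne_zero hab _)
      (fun l _ => by simp [hab.symm])
    rw [hprod, hs] at hsum
    rw [← hsum, Finset.mul_sum]
    refine Finset.sum_congr rfl fun l _ => ?_
    rw [if_neg (by omega), hrefl, Odd.neg_one_pow ⟨l, rfl⟩, pow_mul ξ 2 l]
    congr 2
    ring
  · intro j hj
    have he : Even (j + 1) := by rw [Nat.even_iff]; omega
    rw [hrefl, he.neg_one_pow, one_mul, sub_self, exQuot_zero_right (X_sub_C_mul_X_ne_zero hab _),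
      mul_zero]

theorem dunkl_difference_pow_sub_pow (m i : ℕ) (k₂ : ℂ) (a : Fin 2) :
    pderiv a ((X 0 ^ m - X 1 ^ m : R2) ^ (2 * i + 1))
        - C k₂ * (2 * (X 0 ^ m - X 1 ^ m) ^ (2 * i) * pderiv a (X 0 ^ m - X 1 ^ m))
      = C (2 * i + 1 - 2 * k₂) *
        ((X 0 ^ m - X 1 ^ m) ^ (2 * i) * pderiv a (X 0 ^ m - X 1 ^ m)) := by
  rw [pderiv_pow]
  simp only [map_sub, map_add, map_mul, map_one, map_natCast, map_ofNat, Nat.add_sub_cancel]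
  push_cast
  ring

theorem X_pow_sub_X_pow_ne_zero {m : ℕ} (hm : m ≠ 0) : (X 0 ^ m - X 1 ^ m : R2) ≠ 0 := by
  intro h
  simpa [hm] using congrArg (eval ![1, 0]) h

theorem pderiv_zero_X_pow_sub_X_pow_ne_zero {m : ℕ} (hm : m ≠ 0) :
    pderiv 0 (X 0 ^ m - X 1 ^ m : R2) ≠ 0 := by
  intro h
  simpa [hm, pderiv_pow] using congrArg (eval ![1, 0]) h

/-- For even `d = 2m` with parameters `k₁` on odd reflections and `k₂` on even ones,
the polynomial `(Z^m − W^m)^{2i+1}` is singular iff `k₂ = i + 1/2` (for every `k₁`). -/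
theorem even_minus_singular (m i : ℕ) (hm : 2 ≤ m) (k₁ k₂ : ℂ) (f : R2)
    (hf : f = ((X 0 : R2) ^ m - X 1 ^ m) ^ (2 * i + 1)) :
    (DZ (2 * m) (fun j => if j % 2 = 1 then k₁ else k₂) f = 0 ∧
     DW (2 * m) (fun j => if j % 2 = 1 then k₁ else k₂) f = 0) ↔
      k₂ = (i : ℂ) + 1 / 2 := by
  have hm0 : 0 < m := by omega
  have hζ : IsPrimitiveRoot (zeta (2 * m) ^ 2) m :=
    (zeta_isPrimitiveRoot (by omega)).pow (by omega) rfl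
  have hζ' : IsPrimitiveRoot ((zeta (2 * m))⁻¹ ^ 2) m := by
    rw [inv_pow]
    exact hζ.inv
  have hZ : DZ (2 * m) (fun j => if j % 2 = 1 then k₁ else k₂) f = C (2 * i + 1 - 2 * k₂) *
      ((X 0 ^ m - X 1 ^ m) ^ (2 * i) * pderiv 0 (X 0 ^ m - X 1 ^ m)) := by
    rw [DZ, hf, sum_dunkl_pow_sub_pow hm0 i k₁ k₂ 1 _ hζ (by decide) (by simp),
      dunkl_difference_pow_sub_pow]
  have hW : DW (2 * m) (fun j => if j % 2 = 1 then k₁ else k₂) f = C (2 * i + 1 - 2 * k₂) *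
      ((X 0 ^ m - X 1 ^ m) ^ (2 * i) * pderiv 1 (X 0 ^ m - X 1 ^ m)) := by
    simp only [DW, ← inv_pow]
    rw [hf, sum_dunkl_pow_sub_pow hm0 i k₁ k₂ (-1) _ hζ' (by decide) (by simp),
      dunkl_difference_pow_sub_pow]
  have hk : k₂ = (i : ℂ) + 1 / 2 ↔ 2 * (i : ℂ) + 1 - 2 * k₂ = 0 := by
    constructor <;> intro h
    · rw [h]; ring
    · linear_combination -h / 2
  rw [hZ, hW, hk]
  constructor
  · rintro ⟨h, -⟩
    have hne := mul_ne_zero (pow_ne_zero (2 * i) (X_pow_sub_X_pow_ne_zero hm0.ne'))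
      (pderiv_zero_X_pow_sub_X_pow_ne_zero hm0.ne')
    exact C_eq_zero.1 ((mul_eq_zero.1 h).resolve_right hne)
  · intro h
    simp [h]

end
end

section
/- Let d = 2m+1 be odd and let the parameter function be constant, k_j = c for all j. Suppose c = r/d where r is a positive integer not divisible by d. Then the ℂ-vector space of singular polynomials with zero constant term, U' = {f ∈ ℂ[Z,W] : D_Z(f) = D_W(f) = 0 and f has zero constant term}, is 2-dimensional, and every element of U' is homogeneous of degree r. -/
open MvPolynomial
open scoped Classical

noncomputable section

/-- The exponent vector of `Z^a W^b`. -/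
def expVec (a b : ℕ) : Fin 2 →₀ ℕ := Finsupp.single 0 a + Finsupp.single 1 b

lemma eq_expVec (s : Fin 2 →₀ ℕ) : s = expVec (s 0) (s 1) := by
  ext i
  fin_cases i <;> simp [expVec]

lemma expVec_inj {a b a' b' : ℕ} : expVec a b = expVec a' b' ↔ a = a' ∧ b = b' := by
  constructor
  · intro h
    exact ⟨by simpa [expVec] using DFunLike.congr_fun h 0,
      by simpa [expVec] using DFunLike.congr_fun h 1⟩
  · rintro ⟨rfl, rfl⟩
    rfl

lemma ext_expVec {f g : R2} (h : ∀ a b, coeff (expVec a b) f = coeff (expVec a b) g) :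
    f = g := by
  ext s
  rw [eq_expVec s]
  exact h _ _

lemma expVec_succ_left (a b : ℕ) : expVec (a + 1) b = Finsupp.single 0 1 + expVec a b := by
  ext i
  fin_cases i <;> simp [expVec, add_comm]

lemma expVec_succ_right (a b : ℕ) : expVec a (b + 1) = Finsupp.single 1 1 + expVec a b := by
  ext i
  fin_cases i <;> simp [expVec, add_comm]

lemma coeff_mul_linear_zero (w : ℂ) (g : R2) (p : ℕ) :
    coeff (expVec (p + 1) 0) ((X 0 - C w * X 1) * g) = coeff (expVec p 0) g := by
  rw [sub_mul, coeff_sub, mul_assoc, coeff_C_mul, expVec_succ_left, coeff_X_mul,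
    coeff_X_mul', if_neg]
  · simp
  · simp [expVec]

lemma coeff_mul_linear_succ (w : ℂ) (g : R2) (p q : ℕ) :
    coeff (expVec (p + 1) (q + 1)) ((X 0 - C w * X 1) * g) =
      coeff (expVec p (q + 1)) g - w * coeff (expVec (p + 1) q) g := by
  rw [sub_mul, coeff_sub, mul_assoc, coeff_C_mul]
  conv_lhs =>
    enter [1]
    rw [expVec_succ_left, coeff_X_mul]
  rw [expVec_succ_right (p + 1) q, coeff_X_mul]

/-- The coefficients of a polynomial, recovered from its product with `Z - wW`. -/
lemma coeff_eq_sum_mul_linear (w : ℂ) (g : R2) (p q : ℕ) :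
    coeff (expVec p q) g = ∑ i ∈ Finset.range (q + 1),
      w ^ i * coeff (expVec (p + 1 + i) (q - i)) ((X 0 - C w * X 1) * g) := by
  induction q generalizing p with
  | zero => simp [coeff_mul_linear_zero]
  | succ q ih =>
    rw [Finset.sum_range_succ', eq_comm]
    simp only [pow_zero, one_mul, add_zero, Nat.sub_zero, coeff_mul_linear_succ]
    rw [ih (p + 1), Finset.mul_sum, ← sub_eq_zero]
    have : ∀ i, p + 1 + 1 + i = p + 1 + (i + 1) := fun i => by ring
    simp only [Nat.add_sub_add_right, pow_succ, this]
    simp only [mul_comm, mul_assoc]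
    ring

lemma reflAct_monomial (d j a b : ℕ) (x : ℂ) :
    reflAct d j (monomial (expVec a b) x) =
      monomial (expVec b a) (x * (zeta d ^ j) ^ a * ((zeta d ^ j)⁻¹) ^ b) := by
  rw [reflAct, aeval_monomial, expVec, Finsupp.prod_add_index' (by simp) (by intros; ring)]
  simp only [Finsupp.prod_single_index, pow_zero, Matrix.cons_val_zero, Matrix.cons_val_one,
    mul_pow, ← C_pow]
  rw [monomial_eq, expVec, Finsupp.prod_add_index' (by simp) (by intros; ring)]
  simp only [Finsupp.prod_single_index, pow_zero, C_mul, algebraMap_eq]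
  ring

lemma coeff_reflAct (d j a b : ℕ) (f : R2) :
    coeff (expVec a b) (reflAct d j f) =
      (zeta d ^ j) ^ b * ((zeta d ^ j)⁻¹) ^ a * coeff (expVec b a) f := by
  induction f using MvPolynomial.induction_on' with
  | monomial s x =>
    rw [eq_expVec s, reflAct_monomial, coeff_monomial, coeff_monomial]
    simp only [expVec_inj]
    by_cases h : s 0 = b ∧ s 1 = a
    · rw [if_pos h, if_pos h.symm, h.1, h.2]
      ring
    · rw [if_neg h, if_neg (fun h' => h h'.symm), mul_zero]
  | add f g hf hg => simp [hf, hg, mul_add]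

lemma zeta_ne_zero (d : ℕ) : zeta d ≠ 0 := Complex.exp_ne_zero _

lemma linear_dvd_sub_reflAct (d j : ℕ) (f : R2) :
    X 0 - C (zeta d ^ j) * X 1 ∣ f - reflAct d j f := by
  have hw : C (σ := Fin 2) ((zeta d ^ j)⁻¹) * C (zeta d ^ j) = 1 := by
    rw [← C_mul, inv_mul_cancel₀ (pow_ne_zero _ (zeta_ne_zero d)), C_1]
  induction f using MvPolynomial.induction_on with
  | C a => simp [reflAct]
  | add f g hf hg =>
    rw [map_add, add_sub_add_comm]
    exact dvd_add hf hg
  | mul_X f i hf =>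
    obtain ⟨q, hq⟩ := hf
    fin_cases i
    · refine ⟨q * X 0 + reflAct d j f, ?_⟩
      have : reflAct d j (X 0) = C (zeta d ^ j) * X 1 := by simp [reflAct]
      simp only [Fin.zero_eta, map_mul, this]
      linear_combination X 0 * hq
    · refine ⟨q * X 1 - C ((zeta d ^ j)⁻¹) * reflAct d j f, ?_⟩
      have : reflAct d j (X 1) = C ((zeta d ^ j)⁻¹) * X 0 := by simp [reflAct]
      simp only [Fin.mk_one, map_mul, this]
      linear_combination X 1 * hq - reflAct d j f * X 1 * hw

lemma mul_exQuot {a b : R2} (h : a ∣ b) : a * exQuot a b = b := by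
  have h' : ∃ c, b = a * c := h
  rw [exQuot, dif_pos h']
  exact (Classical.choose_spec h').symm

lemma linear_ne_zero (w : ℂ) : (X 0 - C w * X 1 : R2) ≠ 0 := by
  intro h
  have := congrArg (coeff (expVec (0 + 1) 0)) h
  rw [← mul_one (X 0 - C w * X 1 : R2), coeff_mul_linear_zero] at this
  simp [expVec] at this

lemma exQuot_linear_W (d j : ℕ) (f : R2) :
    exQuot (X 1 - C ((zeta d ^ j)⁻¹) * X 0) (f - reflAct d j f) =
      -C (zeta d ^ j) * exQuot (X 0 - C (zeta d ^ j) * X 1) (f - reflAct d j f) := by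
  have hw : C (σ := Fin 2) ((zeta d ^ j)⁻¹) * C (zeta d ^ j) = 1 := by
    rw [← C_mul, inv_mul_cancel₀ (pow_ne_zero _ (zeta_ne_zero d)), C_1]
  have hZ := mul_exQuot (linear_dvd_sub_reflAct d j f)
  have hdvd : X 1 - C ((zeta d ^ j)⁻¹) * X 0 ∣ f - reflAct d j f := by
    refine ⟨-C (zeta d ^ j) * exQuot (X 0 - C (zeta d ^ j) * X 1) (f - reflAct d j f), ?_⟩
    linear_combination -hZ - X 0 * exQuot (X 0 - C (zeta d ^ j) * X 1) (f - reflAct d j f) * hw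
  apply mul_left_cancel₀ (linear_ne_zero (zeta d ^ j))
  linear_combination -C (zeta d ^ j) * mul_exQuot hdvd + C (zeta d ^ j) * hZ
    - X 0 * exQuot (X 1 - C ((zeta d ^ j)⁻¹) * X 0) (f - reflAct d j f) * hw

/-- Orthogonality of the characters of `ℤ/d`. -/
lemma sum_zeta_zpow {d : ℕ} (hd : d ≠ 0) (k : ℤ) :
    ∑ j ∈ Finset.Icc 1 d, (zeta d ^ j) ^ k = if (d : ℤ) ∣ k then (d : ℂ) else 0 := by
  have hprim : IsPrimitiveRoot (zeta d) d := Complex.isPrimitiveRoot_exp d hd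
  have hcomm : ∀ j : ℕ, (zeta d ^ j) ^ k = (zeta d ^ k) ^ j := fun j => by
    rw [← zpow_natCast, ← zpow_natCast, ← zpow_mul, ← zpow_mul, mul_comm]
  simp only [hcomm]
  split_ifs with h
  · rw [(hprim.zpow_eq_one_iff_dvd k).2 h]
    simp
  · have hne : zeta d ^ k ≠ 1 := fun h' => h ((hprim.zpow_eq_one_iff_dvd k).1 h')
    have hpow : (zeta d ^ k) ^ d = 1 := by rw [← hcomm, hprim.pow_eq_one, one_zpow]
    have hsum := geom_sum_eq hne d
    rw [hpow, sub_self, zero_div] at hsum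
    have hIcc : Finset.Icc 1 d = Finset.Ico (0 + 1) (d + 1) := by ext; simp
    rw [hIcc, ← Finset.sum_Ico_add', Nat.Ico_zero_eq_range]
    simp only [pow_succ]
    rw [← Finset.sum_mul, hsum, zero_mul]

/-- The reflection part of the Dunkl operators in degree `n`, up to a scalar: the sum over
`a ≡ t mod d`, `a ≤ n`, of `x a`, over `a ≥ u` minus over `a ≤ n - v`. -/
def reflSum (d n t u v : ℕ) (x : ℕ → ℂ) : ℂ :=
  ∑ a ∈ Finset.range (n + 1), if a ≡ t [MOD d] then
    (if u ≤ a then x a else 0) - (if a + v ≤ n then x a else 0) else 0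

/-- The coefficients of the degree `n` component of `f`, indexed by the exponent of `Z`. -/
def homCoeff (f : R2) (n a : ℕ) : ℂ := coeff (expVec a (n - a)) f

lemma sum_coeff_exQuot {d : ℕ} (hd : d ≠ 0) (f : R2) {p q t ε : ℕ} (ht : t + ε = p + 1) :
    ∑ j ∈ Finset.Icc 1 d, (zeta d ^ j) ^ ε *
      coeff (expVec p q) (exQuot (X 0 - C (zeta d ^ j) * X 1) (f - reflAct d j f)) =
    d * reflSum d (p + q + 1) t (p + 1) (p + 1) (homCoeff f (p + q + 1)) := by
  have hterm : ∀ j, (zeta d ^ j) ^ ε *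
      coeff (expVec p q) (exQuot (X 0 - C (zeta d ^ j) * X 1) (f - reflAct d j f)) =
      ∑ i ∈ Finset.range (q + 1), ((zeta d ^ j) ^ ((p + 1 + i : ℤ) - t) *
          homCoeff f (p + q + 1) (p + 1 + i) -
        (zeta d ^ j) ^ (((q - i : ℕ) : ℤ) - t) * homCoeff f (p + q + 1) (q - i)) := by
    intro j
    have hw : zeta d ^ j ≠ 0 := pow_ne_zero _ (zeta_ne_zero d)
    rw [coeff_eq_sum_mul_linear (zeta d ^ j), mul_exQuot (linear_dvd_sub_reflAct d j f),
      Finset.mul_sum]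
    refine Finset.sum_congr rfl fun i hi => ?_
    have hi : i ≤ q := Nat.lt_succ_iff.1 (Finset.mem_range.1 hi)
    have h₁ : (p + 1 + i : ℤ) - t = ((ε + i : ℕ) : ℤ) := by push_cast; omega
    have h₂ : ((q - i : ℕ) : ℤ) - t =
        ((ε + i : ℕ) : ℤ) + ((q - i : ℕ) : ℤ) - ((p + 1 + i : ℕ) : ℤ) := by push_cast; omega
    have h₃ : p + q + 1 - (p + 1 + i) = q - i := by omega
    have h₄ : p + q + 1 - (q - i) = p + 1 + i := by omega
    rw [coeff_sub, coeff_reflAct, homCoeff, homCoeff, h₁, h₂, h₃, h₄, zpow_sub₀ hw, zpow_add₀ hw,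
      zpow_natCast, zpow_natCast, zpow_natCast, inv_pow, pow_add]
    ring
  simp only [hterm]
  rw [Finset.sum_comm]
  simp only [Finset.sum_sub_distrib, ← Finset.sum_mul, sum_zeta_zpow hd]
  rw [reflSum, Finset.mul_sum]
  have hsplit : ∀ a, (d : ℂ) * (if a ≡ t [MOD d] then
      (if p + 1 ≤ a then homCoeff f (p + q + 1) a else 0) -
        (if a + (p + 1) ≤ p + q + 1 then homCoeff f (p + q + 1) a else 0) else 0) =
      (if p + 1 ≤ a then (if (d : ℤ) ∣ (a : ℤ) - t then (d : ℂ) else 0) *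
        homCoeff f (p + q + 1) a else 0) -
      (if a < q + 1 then (if (d : ℤ) ∣ (a : ℤ) - t then (d : ℂ) else 0) *
        homCoeff f (p + q + 1) a else 0) := by
    intro a
    have h₁ : a ≡ t [MOD d] ↔ (d : ℤ) ∣ (a : ℤ) - t := by
      rw [Nat.ModEq.comm, Nat.modEq_iff_dvd]
    have h₂ : a + (p + 1) ≤ p + q + 1 ↔ a < q + 1 := by omega
    simp only [h₁, h₂]
    split_ifs <;> ring
  simp only [hsplit, Finset.sum_sub_distrib]
  congr 1
  · rw [show p + q + 1 + 1 = (p + 1) + (q + 1) by ring, Finset.sum_range_add _ (p + 1) (q + 1)]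
    rw [Finset.sum_eq_zero (s := Finset.range (p + 1)), zero_add]
    · refine Finset.sum_congr rfl fun i _ => ?_
      rw [if_pos (Nat.le_add_right (p + 1) i)]
      push_cast
      rfl
    · intro a ha
      rw [Finset.mem_range] at ha
      rw [if_neg (by omega)]
  · rw [show p + q + 1 + 1 = (q + 1) + (p + 1) by ring, Finset.sum_range_add _ (q + 1) (p + 1),
      eq_comm, ← Finset.sum_range_reflect _ (q + 1)]
    rw [Finset.sum_eq_zero (s := Finset.range (p + 1)), add_zero]
    · refine Finset.sum_congr rfl fun i _ => ?_
      rw [if_pos (by omega), show q + 1 - 1 - i = q - i by omega]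
    · intro a ha
      rw [if_neg (by omega)]

lemma coeff_pderiv_Z (f : R2) (p q : ℕ) :
    coeff (expVec p q) (pderiv 0 f) = (p + 1) * coeff (expVec (p + 1) q) f := by
  rw [coeff_pderiv, expVec_succ_left, add_comm (Finsupp.single 0 1)]
  simp [expVec, mul_comm]

lemma coeff_pderiv_W (f : R2) (p q : ℕ) :
    coeff (expVec p q) (pderiv 1 f) = (q + 1) * coeff (expVec p (q + 1)) f := by
  rw [coeff_pderiv, expVec_succ_right, add_comm (Finsupp.single 1 1)]
  simp [expVec, mul_comm]

lemma coeff_DZ {d : ℕ} (hd : d ≠ 0) (c : ℂ) (f : R2) (p q : ℕ) :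
    coeff (expVec p q) (DZ d (fun _ => c) f) =
      ((p + 1 : ℕ) : ℂ) * homCoeff f (p + q + 1) (p + 1) -
        c * d * reflSum d (p + q + 1) (p + 1) (p + 1) (p + 1) (homCoeff f (p + q + 1)) := by
  have h := sum_coeff_exQuot hd f (p := p) (q := q) (t := p + 1) (ε := 0) rfl
  simp only [pow_zero, one_mul] at h
  rw [DZ, coeff_sub, coeff_sum, coeff_pderiv_Z]
  simp only [coeff_C_mul]
  rw [← Finset.mul_sum, h, homCoeff, show p + q + 1 - (p + 1) = q by omega]
  push_cast
  ring

lemma coeff_DW {d : ℕ} (hd : d ≠ 0) (c : ℂ) (f : R2) (p q : ℕ) :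
    coeff (expVec p q) (DW d (fun _ => c) f) =
      ((q + 1 : ℕ) : ℂ) * homCoeff f (p + q + 1) p +
        c * d * reflSum d (p + q + 1) p (p + 1) (p + 1) (homCoeff f (p + q + 1)) := by
  have h := sum_coeff_exQuot hd f (p := p) (q := q) (t := p) (ε := 1) rfl
  simp only [pow_one] at h
  rw [DW, coeff_sub, coeff_sum, coeff_pderiv_W]
  simp only [exQuot_linear_W, neg_mul, mul_neg, coeff_neg, coeff_C_mul, Finset.sum_neg_distrib]
  rw [← Finset.mul_sum, h, homCoeff, show p + q + 1 - p = q + 1 by omega]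
  push_cast
  ring

/-- The equations satisfied by the degree `n` coefficients of a polynomial killed by `D_Z`
and by the Euler-type operator `Z D_Z + W D_W`. -/
def SingularSeq (d r n : ℕ) (x : ℕ → ℂ) : Prop :=
  ∀ p ≤ n, (p : ℂ) * x p = r * reflSum d n p p p x ∧
    (n : ℂ) * x p = r * (x p - if n ≡ 2 * p [MOD d] then x (n - p) else 0)

lemma reflSum_zero (d n t : ℕ) (x : ℕ → ℂ) : reflSum d n t 0 0 x = 0 := by
  rw [reflSum]
  refine Finset.sum_eq_zero fun a ha => ?_
  rw [Finset.mem_range] at ha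
  simp [show a ≤ n by omega]

lemma reflSum_top (d n t : ℕ) (x : ℕ → ℂ) : reflSum d n t (n + 1) (n + 1) x = 0 := by
  rw [reflSum]
  refine Finset.sum_eq_zero fun a ha => ?_
  rw [Finset.mem_range] at ha
  simp [show ¬ n + 1 ≤ a by omega, show ¬ a + (n + 1) ≤ n by omega]

lemma reflSum_sub_succ (d n p : ℕ) (hp : p ≤ n) (x : ℕ → ℂ) :
    reflSum d n p p p x - reflSum d n p (p + 1) (p + 1) x =
      x p - if n ≡ 2 * p [MOD d] then x (n - p) else 0 := by
  have hmod : n - p ≡ p [MOD d] ↔ n ≡ 2 * p [MOD d] := by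
    constructor
    · intro h
      have := h.add_right p
      rwa [Nat.sub_add_cancel hp, ← two_mul] at this
    · intro h
      refine Nat.ModEq.add_right_cancel' p ?_
      rwa [Nat.sub_add_cancel hp, ← two_mul]
  rw [reflSum, reflSum, ← Finset.sum_sub_distrib]
  have hterm : ∀ a, ((if a ≡ p [MOD d] then
      (if p ≤ a then x a else 0) - (if a + p ≤ n then x a else 0) else 0) -
      (if a ≡ p [MOD d] then
      (if p + 1 ≤ a then x a else 0) - (if a + (p + 1) ≤ n then x a else 0) else 0)) =
      (if a = p then x p else 0) -
        (if a = n - p then (if n ≡ 2 * p [MOD d] then x (n - p) else 0) else 0) := by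
    intro a
    have h₁ : ((if p ≤ a then x a else 0) - (if p + 1 ≤ a then x a else 0)) =
        (if a = p then x p else 0) := by
      rcases lt_trichotomy a p with h | rfl | h
      · simp [h.ne, h.not_ge, show ¬ p + 1 ≤ a by omega]
      · simp
      · simp [h.ne', h.le, show p + 1 ≤ a by omega]
    have h₂ : ((if a + p ≤ n then x a else 0) - (if a + (p + 1) ≤ n then x a else 0)) =
        (if a = n - p then x (n - p) else 0) := by
      rcases lt_trichotomy a (n - p) with h | rfl | h
      · simp [h.ne, show a + p ≤ n by omega, show a + (p + 1) ≤ n by omega]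
      · simp [hp, show ¬ n - p + (p + 1) ≤ n by omega]
      · simp [h.ne', show ¬ a + p ≤ n by omega, show ¬ a + (p + 1) ≤ n by omega]
    by_cases ha : a ≡ p [MOD d]
    · rw [if_pos ha, if_pos ha, ← h₁]
      have : (if a = n - p then (if n ≡ 2 * p [MOD d] then x (n - p) else 0) else 0) =
          (if a = n - p then x (n - p) else 0) := by
        split_ifs with h h'
        · rfl
        · exact absurd (hmod.1 (h ▸ ha)) h'
        · rfl
      rw [this, ← h₂]
      ring
    · have h₃ : a ≠ p := fun h => ha (h ▸ Nat.ModEq.refl _)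
      rw [if_neg ha, if_neg ha, if_neg h₃]
      split_ifs with h h'
      · exact absurd (h ▸ hmod.2 h') ha
      · simp
      · simp
  simp only [hterm, Finset.sum_sub_distrib, Finset.sum_ite_eq', Finset.mem_range]
  rw [if_pos (by omega), if_pos (by omega)]

/-- A polynomial is singular iff its homogeneous components satisfy `SingularSeq`. -/
lemma singular_iff {d r : ℕ} (hd : d ≠ 0) {c : ℂ} (hc : c * d = r) (f : R2) :
    (DZ d (fun _ => c) f = 0 ∧ DW d (fun _ => c) f = 0) ↔
      ∀ n, SingularSeq d r n (homCoeff f n) := by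
  constructor
  · rintro ⟨hZ, hW⟩ n p hp
    have hz : (p : ℂ) * homCoeff f n p = r * reflSum d n p p p (homCoeff f n) := by
      obtain _ | p := p
      · simp [reflSum_zero]
      · obtain ⟨q, rfl⟩ := Nat.exists_eq_add_of_le hp
        have := coeff_DZ hd c f p q
        rw [hZ, coeff_zero, hc] at this
        rw [show p + 1 + q = p + q + 1 by ring]
        exact (sub_eq_zero.1 this.symm)
    have hw : ((n : ℂ) - p) * homCoeff f n p =
        -(r * reflSum d n p (p + 1) (p + 1) (homCoeff f n)) := by
      obtain ⟨q, rfl⟩ := Nat.exists_eq_add_of_le hp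
      obtain _ | q := q
      · simp [reflSum_top]
      · have := coeff_DW hd c f p q
        rw [hW, coeff_zero, hc] at this
        rw [show p + (q + 1) = p + q + 1 by ring, ← sub_eq_zero, this]
        push_cast
        ring
    refine ⟨hz, ?_⟩
    rw [← reflSum_sub_succ d n p hp]
    linear_combination hz + hw
  · intro h
    constructor
    · refine ext_expVec fun p q => ?_
      rw [coeff_DZ hd, hc, coeff_zero, (h (p + q + 1) (p + 1) (by omega)).1, sub_self]
    · refine ext_expVec fun p q => ?_
      have hs := h (p + q + 1) p (by omega)
      rw [← reflSum_sub_succ d _ p (by omega)] at hs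
      rw [coeff_DW hd, hc, coeff_zero]
      have h₂ := hs.2
      push_cast at h₂ ⊢
      linear_combination h₂ - hs.1

/-- If the terms of `x` strictly outside `[n - p, p]` in the class of `p` vanish, only the end
terms contribute. -/
lemma reflSum_of_lt {d n p : ℕ} (hp : p ≤ n) (hlt : n - p < p) {x : ℕ → ℂ}
    (hx : ∀ a ≤ n, min a (n - a) < n - p → x a = 0) :
    reflSum d n p p p x = x p - if n ≡ 2 * p [MOD d] then x (n - p) else 0 := by
  rw [← reflSum_sub_succ d n p hp, eq_comm, sub_eq_self, reflSum]
  refine Finset.sum_eq_zero fun a ha => ?_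
  rw [Finset.mem_range] at ha
  split_ifs <;> first | omega | simp [hx a (by omega) (by omega)] | simp

lemma reflSum_of_gt {d n p : ℕ} (hlt : p ≤ n - p) {x : ℕ → ℂ}
    (hx : ∀ a ≤ n, min a (n - a) < p → x a = 0) :
    reflSum d n p p p x = 0 := by
  rw [reflSum]
  refine Finset.sum_eq_zero fun a ha => ?_
  rw [Finset.mem_range] at ha
  split_ifs <;> first | omega | simp [hx a (by omega) (by omega)] | simp

/-- In degree `r` a solution is determined by its two extreme coefficients. -/
lemma eq_zero_of_extreme {d n : ℕ} (x : ℕ → ℂ)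
    (h0 : x 0 = 0) (hn : x n = 0) (hbad : ∀ p ≤ n, n ≡ 2 * p [MOD d] → x p = 0)
    (hgood : ∀ p, 0 < p → p < n → ¬ n ≡ 2 * p [MOD d] →
      (p : ℂ) * x p = n * reflSum d n p p p x) :
    ∀ p ≤ n, x p = 0 := by
  suffices ∀ k p, p ≤ n → min p (n - p) = k → x p = 0 from fun p hp => this _ p hp rfl
  intro k
  induction k using Nat.strong_induction_on with
  | _ k ih =>
  intro p hp hk
  by_cases hb : n ≡ 2 * p [MOD d]
  · exact hbad p hp hb
  rcases Nat.eq_zero_or_pos p with rfl | hp0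
  · exact h0
  rcases hp.eq_or_lt with rfl | hpn
  · exact hn
  have heq := hgood p hp0 hpn hb
  rcases lt_or_ge (n - p) p with hlt | hge
  · rw [reflSum_of_lt hp hlt fun a ha hm => ih _ (by omega) a ha rfl, if_neg hb, sub_zero,
      mul_eq_mul_right_iff] at heq
    rcases heq with heq | heq
    · exact absurd (Nat.cast_injective heq) hpn.ne
    · exact heq
  · rw [reflSum_of_gt hge fun a ha hm => ih _ (by omega) a ha rfl, mul_zero, mul_eq_zero] at heq
    exact heq.resolve_left (Nat.cast_ne_zero.2 hp0.ne')

lemma two_mul_sub_modEq {d n p : ℕ} (hp : p ≤ n) (h : n ≡ 2 * p [MOD d]) :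
    n ≡ 2 * (n - p) [MOD d] := by
  have := h.add_left (2 * (n - p))
  rw [← mul_add, Nat.sub_add_cancel hp, two_mul n] at this
  exact (Nat.ModEq.add_right_cancel' n this).symm

/-- There are no solutions in positive degrees other than `r`. -/
lemma SingularSeq.eq_zero_of_ne {d r n : ℕ} (hd : Odd d) (hrd : ¬ d ∣ r) (hn : 0 < n)
    (hnr : n ≠ r) {x : ℕ → ℂ} (hx : SingularSeq d r n x) : ∀ p ≤ n, x p = 0 := by
  have hn' : (n : ℂ) ≠ 0 := Nat.cast_ne_zero.2 hn.ne'
  have hnr' : (n : ℂ) - r ≠ 0 := sub_ne_zero.2 fun h => hnr (Nat.cast_injective h)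
  have hgood : ∀ p ≤ n, ¬ n ≡ 2 * p [MOD d] → x p = 0 := by
    intro p hp hb
    have h := (hx p hp).2
    rw [if_neg hb] at h
    exact (mul_eq_zero.1 (show ((n : ℂ) - r) * x p = 0 by linear_combination h)).resolve_left hnr'
  have hbad : ∀ p ≤ n, n ≡ 2 * p [MOD d] → ((n : ℂ) - r) * x p = -(r * x (n - p)) := by
    intro p hp hb
    have h := (hx p hp).2
    rw [if_pos hb] at h
    linear_combination h
  by_cases hn2 : n = 2 * r
  · have hr : (r : ℂ) ≠ 0 := by
      rintro h
      exact hrd (by simp [Nat.cast_eq_zero.1 h])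
    have hanti : ∀ p ≤ n, n ≡ 2 * p [MOD d] → x (n - p) = -x p := by
      intro p hp hb
      have h := hbad p hp hb
      rw [hn2] at h ⊢
      push_cast at h
      apply mul_left_cancel₀ hr
      linear_combination h
    suffices ∀ k p, p ≤ n → min p (n - p) = k → x p = 0 from fun p hp => this _ p hp rfl
    intro k
    induction k using Nat.strong_induction_on with
    | _ k ih =>
    have hright : ∀ p ≤ n, n - p < p → min p (n - p) = k → x p = 0 := by
      intro p hp hlt hk
      by_cases hb : n ≡ 2 * p [MOD d]
      · have heq := (hx p hp).1
        rw [reflSum_of_lt hp hlt fun a ha hm => ih _ (by omega) a ha rfl, if_pos hb,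
          hanti p hp hb] at heq
        have : ((p : ℂ) - n) * x p = 0 := by
          rw [hn2]
          push_cast
          linear_combination heq
        refine (mul_eq_zero.1 this).resolve_left (sub_ne_zero.2 fun h => hrd ?_)
        rw [Nat.cast_injective h] at hb
        have hdn : d ∣ n := by
          have := (Nat.modEq_iff_dvd' (by omega)).1 hb
          rwa [two_mul, Nat.add_sub_cancel] at this
        rw [hn2] at hdn
        exact (Nat.Coprime.dvd_mul_left hd.coprime_two_right).1 hdn
      · exact hgood p hp hb
    intro p hp hk
    by_cases hb : n ≡ 2 * p [MOD d]
    · rcases lt_trichotomy (n - p) p with hlt | heq | hgt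
      · exact hright p hp hlt hk
      · have := hanti p hp hb
        rw [heq] at this
        exact self_eq_neg.1 this
      · have h := hright (n - p) (by omega) (by omega) (by omega)
        rw [hanti p hp hb] at h
        exact neg_eq_zero.1 h
    · exact hgood p hp hb
  · intro p hp
    by_cases hb : n ≡ 2 * p [MOD d]
    · have h₁ := hbad p hp hb
      have h₂ := hbad (n - p) (by omega) (two_mul_sub_modEq hp hb)
      rw [Nat.sub_sub_self hp] at h₂
      have hn2' : (n : ℂ) - 2 * r ≠ 0 := sub_ne_zero.2 fun h => hn2 (by exact_mod_cast h)
      have : ((n : ℂ) * (n - 2 * r)) * x p = 0 := by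
        linear_combination ((n : ℂ) - r) * h₁ - r * h₂
      exact (mul_eq_zero.1 this).resolve_left (mul_ne_zero hn' hn2')
    · exact hgood p hp hb

/-- In degree `r` the coefficients in the self-dual class vanish. -/
lemma SingularSeq.eq_zero_of_modEq {d r : ℕ} (hr : 0 < r) {x : ℕ → ℂ}
    (hx : SingularSeq d r r x) : ∀ p ≤ r, r ≡ 2 * p [MOD d] → x p = 0 := by
  intro p hp hb
  have hb' := two_mul_sub_modEq hp hb
  have h := (hx (r - p) (Nat.sub_le _ _)).2
  rw [if_pos hb', Nat.sub_sub_self hp] at h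
  have hr' : (r : ℂ) ≠ 0 := Nat.cast_ne_zero.2 hr.ne'
  apply mul_left_cancel₀ hr'
  linear_combination h

lemma SingularSeq.eq_zero_of_extreme {d r : ℕ} (hr : 0 < r) {x : ℕ → ℂ}
    (hx : SingularSeq d r r x) (h0 : x 0 = 0) (hn : x r = 0) : ∀ p ≤ r, x p = 0 :=
  _root_.eq_zero_of_extreme x h0 hn (hx.eq_zero_of_modEq hr) fun p _ hp _ => (hx p hp.le).1

/-- Extension of a finite sequence by zero. -/
def extendZero (n : ℕ) : (Fin (n + 1) → ℂ) →ₗ[ℂ] (ℕ → ℂ) where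
  toFun y a := if h : a < n + 1 then y ⟨a, h⟩ else 0
  map_add' y z := by
    ext a
    by_cases h : a < n + 1 <;>
      simp only [Pi.add_apply, dif_pos, dif_neg, h, not_false_eq_true, add_zero]
  map_smul' s y := by
    ext a
    by_cases h : a < n + 1 <;>
      simp only [Pi.smul_apply, dif_pos, dif_neg, h, not_false_eq_true, smul_zero,
        RingHom.id_apply]

/-- `reflSum` as a linear functional. -/
def reflSumₗ (d n t u v : ℕ) : (ℕ → ℂ) →ₗ[ℂ] ℂ where
  toFun := reflSum d n t u v
  map_add' x y := by
    rw [reflSum, reflSum, reflSum, ← Finset.sum_add_distrib]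
    refine Finset.sum_congr rfl fun a _ => ?_
    simp only [Pi.add_apply]
    split_ifs <;> ring
  map_smul' s x := by
    rw [reflSum, reflSum, RingHom.id_apply, smul_eq_mul, Finset.mul_sum]
    refine Finset.sum_congr rfl fun a _ => ?_
    simp only [Pi.smul_apply, smul_eq_mul]
    split_ifs <;> ring

/-- The square system determining the solutions in degree `n` with prescribed extreme
coefficients. -/
def extremeSystem (d n : ℕ) : (Fin (n + 1) → ℂ) →ₗ[ℂ] (Fin (n + 1) → ℂ) :=
  LinearMap.pi fun p =>
    if (p : ℕ) = 0 ∨ (p : ℕ) = n ∨ n ≡ 2 * p [MOD d] then LinearMap.proj p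
    else (p : ℂ) • LinearMap.proj p - (n : ℂ) • (reflSumₗ d n p p p ∘ₗ extendZero n)

lemma extremeSystem_apply (d n : ℕ) (y : Fin (n + 1) → ℂ) (p : Fin (n + 1)) :
    extremeSystem d n y p = if (p : ℕ) = 0 ∨ (p : ℕ) = n ∨ n ≡ 2 * p [MOD d] then y p
      else (p : ℂ) * y p - n * reflSum d n p p p (extendZero n y) := by
  rw [extremeSystem, LinearMap.pi_apply]
  split_ifs <;> simp [reflSumₗ]

lemma extendZero_apply {n a : ℕ} (y : Fin (n + 1) → ℂ) (h : a < n + 1) :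
    extendZero n y a = y ⟨a, h⟩ := by
  exact dif_pos h

lemma extremeSystem_injective (d n : ℕ) : Function.Injective (extremeSystem d n) := by
  rw [injective_iff_map_eq_zero]
  intro y hy
  have hp : ∀ p (h : p < n + 1), (if p = 0 ∨ p = n ∨ n ≡ 2 * p [MOD d] then extendZero n y p
      else (p : ℂ) * extendZero n y p - n * reflSum d n p p p (extendZero n y)) = 0 := by
    intro p h
    have := congrFun hy ⟨p, h⟩
    rw [extremeSystem_apply] at this
    simpa [extendZero_apply y h] using this
  have := eq_zero_of_extreme (d := d) (n := n) (extendZero n y)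
    (by simpa using hp 0 (by omega)) (by simpa using hp n (by omega))
    (fun p hpn hb => by simpa [hb] using hp p (by omega))
    (fun p h0 hpn hb => by simpa [hb, h0.ne', hpn.ne, sub_eq_zero] using hp p (by omega))
  ext ⟨p, h⟩
  rw [← extendZero_apply y h]
  exact this p (by omega)

/-- In degree `r` the two extreme coefficients can be prescribed arbitrarily. -/
lemma exists_singularSeq {d r : ℕ} (hrd : ¬ d ∣ r) (α β : ℂ) :
    ∃ x : ℕ → ℂ, SingularSeq d r r x ∧ x 0 = α ∧ x r = β := by
  have hr : r ≠ 0 := fun h => hrd (h ▸ dvd_zero d)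
  obtain ⟨y, hy⟩ := (LinearMap.injective_iff_surjective.1 (extremeSystem_injective d r))
    fun p => if (p : ℕ) = 0 then α else if (p : ℕ) = r then β else 0
  have hp : ∀ p (h : p < r + 1), (if p = 0 ∨ p = r ∨ r ≡ 2 * p [MOD d] then extendZero r y p
      else (p : ℂ) * extendZero r y p - r * reflSum d r p p p (extendZero r y)) =
      if p = 0 then α else if p = r then β else 0 := by
    intro p h
    have := congrFun hy ⟨p, h⟩
    rw [extremeSystem_apply] at this
    simpa [extendZero_apply y h] using this
  have h0 : ¬ r ≡ 2 * 0 [MOD d] := fun h => hrd ((Nat.modEq_zero_iff_dvd).1 h)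
  have hrr : ¬ r ≡ 2 * r [MOD d] := fun h => h0 (by
    simpa using two_mul_sub_modEq le_rfl h)
  have hbad : ∀ p ≤ r, r ≡ 2 * p [MOD d] → extendZero r y p = 0 := by
    intro p hpr hb
    have h₁ : p ≠ 0 := fun h => h0 (h ▸ hb)
    have h₂ : p ≠ r := fun h => hrr (by rwa [h] at hb)
    simpa [hb, h₁, h₂] using hp p (by omega)
  refine ⟨extendZero r y, fun p hpr => ⟨?_, ?_⟩, by simpa using hp 0 (by omega),
    by simpa [hr] using hp r (by omega)⟩
  · by_cases hb : r ≡ 2 * p [MOD d]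
    · rw [hbad p hpr hb, mul_zero, eq_comm, mul_eq_zero]
      right
      rw [reflSum]
      refine Finset.sum_eq_zero fun a ha => ?_
      rw [Finset.mem_range] at ha
      by_cases hap : a ≡ p [MOD d]
      · simp [hbad a (by omega) (hb.trans (hap.symm.mul_left 2))]
      · rw [if_neg hap]
    · rcases Nat.eq_zero_or_pos p with rfl | hp0
      · simp [reflSum_zero]
      rcases hpr.eq_or_lt with rfl | hlt
      · have h := reflSum_sub_succ d p p le_rfl (extendZero p y)
        rw [reflSum_top, sub_zero, if_neg hb, sub_zero] at h
        rw [h]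
      · simpa [hb, hp0.ne', hlt.ne, sub_eq_zero] using hp p (by omega)
  · split_ifs with hb
    · rw [hbad p hpr hb, hbad (r - p) (by omega) (two_mul_sub_modEq hpr hb)]
      simp
    · rw [sub_zero]

/-- The homogeneous polynomial of degree `n` with coefficients `x`. -/
def homPoly (n : ℕ) (x : ℕ → ℂ) : R2 :=
  ∑ a ∈ Finset.range (n + 1), monomial (expVec a (n - a)) (x a)

lemma homCoeff_homPoly (n k a : ℕ) (x : ℕ → ℂ) (ha : a ≤ k) :
    homCoeff (homPoly n x) k a = if k = n then x a else 0 := by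
  rw [homCoeff, homPoly, coeff_sum]
  simp only [coeff_monomial, expVec_inj]
  split_ifs with h
  · subst h
    rw [Finset.sum_eq_single a]
    · simp
    · intro b _ hb
      simp [hb]
    · intro h
      exact absurd (Finset.mem_range.2 (by omega)) h
  · refine Finset.sum_eq_zero fun b hb => ?_
    rw [Finset.mem_range] at hb
    rw [if_neg (by omega)]

lemma reflSum_congr {d n t u v : ℕ} {x y : ℕ → ℂ} (h : ∀ a ≤ n, x a = y a) :
    reflSum d n t u v x = reflSum d n t u v y := by
  rw [reflSum, reflSum]
  refine Finset.sum_congr rfl fun a ha => ?_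
  rw [h a (by rw [Finset.mem_range] at ha; omega)]

lemma SingularSeq.congr {d r n : ℕ} {x y : ℕ → ℂ} (h : ∀ a ≤ n, x a = y a)
    (hx : SingularSeq d r n x) : SingularSeq d r n y := by
  intro p hp
  have := hx p hp
  rwa [reflSum_congr h, h p hp, h (n - p) (by omega)] at this

lemma SingularSeq.zero (d r n : ℕ) : SingularSeq d r n fun _ => 0 := by
  intro p _
  simp [reflSum]

lemma SingularSeq.linear {d r n : ℕ} {x y : ℕ → ℂ} (a b : ℂ) (hx : SingularSeq d r n x)
    (hy : SingularSeq d r n y) : SingularSeq d r n fun i => a * x i + b * y i := by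
  intro p hp
  have hsum : reflSum d n p p p (fun i => a * x i + b * y i) =
      a * reflSum d n p p p x + b * reflSum d n p p p y :=
    (map_add (reflSumₗ d n p p p) (a • x) (b • y)).trans (by simp [reflSumₗ])
  obtain ⟨hx₁, hx₂⟩ := hx p hp
  obtain ⟨hy₁, hy₂⟩ := hy p hp
  refine ⟨?_, ?_⟩
  · rw [hsum]
    linear_combination a * hx₁ + b * hy₁
  · split_ifs at hx₂ hy₂ ⊢ <;> linear_combination a * hx₂ + b * hy₂

lemma ext_homCoeff {f g : R2} (h : ∀ n, ∀ a ≤ n, homCoeff f n a = homCoeff g n a) : f = g := by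
  refine ext_expVec fun a b => ?_
  simpa [homCoeff] using h (a + b) a (by omega)

lemma homCoeff_linear (f g : R2) (a b : ℂ) (n i : ℕ) :
    homCoeff (C a * f + C b * g) n i = a * homCoeff f n i + b * homCoeff g n i := by
  simp [homCoeff]

/-- For odd `d = 2m+1` and constant parameter `c = r/d` with `r` a positive integer
not divisible by `d`, the space `U'` of singular polynomials with zero constant term
is 2-dimensional, and all its elements are homogeneous of degree `r`. -/
theorem odd_singular_space (m r : ℕ) (hm : 1 ≤ m) (hr : 0 < r)
    (hrd : ¬ (2 * m + 1) ∣ r) (c : ℂ) (hc : c = (r : ℂ) / (2 * (m : ℂ) + 1)) :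
    (∃ f₁ f₂ : R2, LinearIndependent ℂ ![f₁, f₂] ∧
      {h : R2 | DZ (2 * m + 1) (fun _ => c) h = 0 ∧
                DW (2 * m + 1) (fun _ => c) h = 0 ∧ constantCoeff h = 0} =
      {h : R2 | ∃ a b : ℂ, h = C a * f₁ + C b * f₂}) ∧
    ∀ h : R2, DZ (2 * m + 1) (fun _ => c) h = 0 →
      DW (2 * m + 1) (fun _ => c) h = 0 → constantCoeff h = 0 →
      h.IsHomogeneous r := by
  have hd : 2 * m + 1 ≠ 0 := by omega
  have hodd : Odd (2 * m + 1) := ⟨m, rfl⟩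
  have hcr : c * ((2 * m + 1 : ℕ) : ℂ) = r := by
    have : ((2 * m + 1 : ℕ) : ℂ) ≠ 0 := Nat.cast_ne_zero.2 hd
    push_cast at this ⊢
    rw [hc, div_mul_cancel₀ _ this]
  have hconst : ∀ h : R2, constantCoeff h = homCoeff h 0 0 := fun h => by
    simp [homCoeff, expVec, constantCoeff_eq]
  have hvanish : ∀ h : R2, DZ (2 * m + 1) (fun _ => c) h = 0 →
      DW (2 * m + 1) (fun _ => c) h = 0 → constantCoeff h = 0 →
      ∀ n ≠ r, ∀ a ≤ n, homCoeff h n a = 0 := by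
    intro h hZ hW h0 n hn a ha
    rcases Nat.eq_zero_or_pos n with rfl | hn0
    · rw [Nat.le_zero.1 ha, ← hconst, h0]
    · exact ((singular_iff hd hcr h).1 ⟨hZ, hW⟩ n).eq_zero_of_ne hodd hrd hn0 hn a ha
  refine ⟨?_, fun h hZ hW h0 s hs => ?_⟩
  · obtain ⟨x, hx, hx0, hxr⟩ := exists_singularSeq hrd 1 0
    obtain ⟨y, hy, hy0, hyr⟩ := exists_singularSeq hrd 0 1
    refine ⟨homPoly r x, homPoly r y, ?_, ?_⟩
    · rw [LinearIndependent.pair_iff]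
      intro a b hab
      rw [smul_eq_C_mul, smul_eq_C_mul] at hab
      have h₁ := homCoeff_linear (homPoly r x) (homPoly r y) a b r 0
      have h₂ := homCoeff_linear (homPoly r x) (homPoly r y) a b r r
      rw [hab] at h₁ h₂
      simp [homCoeff_homPoly, hx0, hy0, hxr, hyr] at h₁ h₂
      simp [homCoeff] at h₁ h₂
      exact ⟨h₁.symm, h₂.symm⟩
    · ext h
      simp only [Set.mem_ofPred_eq]
      constructor
      · rintro ⟨hZ, hW, h0⟩
        refine ⟨homCoeff h r 0, homCoeff h r r, ext_homCoeff fun n a ha => ?_⟩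
        rw [homCoeff_linear, homCoeff_homPoly _ _ _ _ ha, homCoeff_homPoly _ _ _ _ ha]
        by_cases hn : n = r
        · subst hn
          have hlin := (hx.linear (homCoeff h n 0) (homCoeff h n n) hy).linear 1 (-1)
            ((singular_iff hd hcr h).1 ⟨hZ, hW⟩ n)
          have := hlin.eq_zero_of_extreme hr (by simp [hx0, hy0]) (by simp [hxr, hyr]) a ha
          simp only [if_true]
          linear_combination -this
        · rw [if_neg hn, if_neg hn, hvanish h hZ hW h0 n hn a ha]
          simp
      · rintro ⟨a, b, rfl⟩
        rw [← and_assoc, singular_iff hd hcr, hconst, homCoeff_linear,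
          homCoeff_homPoly _ _ _ _ le_rfl, homCoeff_homPoly _ _ _ _ le_rfl]
        refine ⟨fun n => ?_, by simp [hr.ne]⟩
        by_cases hn : n = r
        · subst hn
          refine (hx.linear a b hy).congr fun i hi => ?_
          simp [homCoeff_linear, homCoeff_homPoly, hi]
        · refine (SingularSeq.zero _ _ n).congr fun i hi => ?_
          simp [homCoeff_linear, homCoeff_homPoly, hi, hn]
  · by_contra hne
    refine hs ?_
    have hdeg : s 0 + s 1 ≠ r := by
      rintro rfl
      refine hne ?_
      simp [Finsupp.weight_apply, Finsupp.sum_fintype]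
    have := hvanish h hZ hW h0 _ hdeg (s 0) (by omega)
    rw [homCoeff, Nat.add_sub_cancel_left, ← eq_expVec] at this
    exact this

end
end
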